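/- For all integers 1 ≤ s ≤ T and every bounded measurable function h : X → ℝ with φ_{s|T}(h) = 0, the quantity Γ := Σ_{r=0}^{s} V_{χ,r,s}[h·L_{s,T}(·,1)] / (φ_{s|s}(L_{s,T}(·,1)))² + Σ_{t=s+1}^{T} φ_{t-1|t-1}(υ_{s,t,T})·φ_{t-1|t-1}(ϑ_t) / (φ_{t|t-1}(g_t·L_{t,T}(·,1)))² satisfies Γ ≤ (osc(h)²/(1−ρ²))·[ (1/c₋)·(σ₊/σ₋)²·sup_{r≥0} ‖ω_r‖_∞·‖ϑ_r‖_∞ + (σ₊⁴/(c₋²·σ₋³))·sup_{r≥0} ‖ω_r‖_∞·‖ϑ_r‖_∞·‖g_r‖_∞ ]. -/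

import Mathlib

open MeasureTheory

noncomputable section

variable {X : Type*} [MeasurableSpace X]

/-- `ell ν q g s n x y` is the kernel density `ℓ_{s, s+n+1}(x, y)`:
`ℓ_{s,s+1}(x,y) = q(x,y) g_{s+1}(y)` and
`ℓ_{s,t+1}(x,y) = ∫ ℓ_{s,t}(x,z) q(z,y) g_{t+1}(y) ν(dz)`. -/
def ell (ν : Measure X) (q : X → X → ℝ) (g : ℕ → X → ℝ) (s : ℕ) : ℕ → X → X → ℝ
  | 0 => fun x y => q x y * g (s + 1) y
  | n + 1 => fun x y => ∫ z, ell ν q g s n x z * (q z y * g (s + n + 2) y) ∂ν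

/-- `ℓ_{s,t}` for `s < t`. -/
def ellST (ν : Measure X) (q : X → X → ℝ) (g : ℕ → X → ℝ) (s t : ℕ) : X → X → ℝ :=
  ell ν q g s (t - s - 1)

/-- `L_{s,t}(x,h) = ∫ ℓ_{s,t}(x,y) h(y) ν(dy)`, with the convention `L_{t,t}(x,h) = h x`. -/
def Lop (ν : Measure X) (q : X → X → ℝ) (g : ℕ → X → ℝ) (s t : ℕ) (x : X) (h : X → ℝ) : ℝ :=
  if s < t then ∫ y, ellST ν q g s t x y * h y ∂ν else h x

/-- filtering distribution `φ_{t|t}(h)` (for `t = 0` this is `χ(g₀h)/χ(g₀)`). -/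
def philt (ν χ : Measure X) (q : X → X → ℝ) (g : ℕ → X → ℝ) (t : ℕ) (h : X → ℝ) : ℝ :=
  (∫ x, g 0 x * Lop ν q g 0 t x h ∂χ) / ∫ x, g 0 x * Lop ν q g 0 t x (fun _ => 1) ∂χ

/-- one-step predictor `φ_{t|t-1}(h) = φ_{t-1|t-1}(x ↦ ∫ q(x,y)h(y)ν(dy))`. -/
def phipred (ν χ : Measure X) (q : X → X → ℝ) (g : ℕ → X → ℝ) (t : ℕ) (h : X → ℝ) : ℝ :=
  philt ν χ q g (t - 1) (fun x => ∫ y, q x y * h y ∂ν)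

/-- importance weight `ω_t(x,x') = q(x,x') g_t(x') / (ϑ_t(x) p_t(x,x'))`. -/
def omegaFn (q : X → X → ℝ) (g : ℕ → X → ℝ) (ϑ : ℕ → X → ℝ) (p : ℕ → X → X → ℝ)
    (t : ℕ) (x y : X) : ℝ :=
  q x y * g t y / (ϑ t x * p t x y)

/-- oscillation of a function -/
def osc {Y : Type*} (h : Y → ℝ) : ℝ := ⨆ pr : Y × Y, |h pr.1 - h pr.2|

/-- `V_{χ,0,s}[h]`, where `d0` is the density `dχ/dρ₀`. -/
def V0 (ν ρ₀ χ : Measure X) (q : X → X → ℝ) (g : ℕ → X → ℝ) (d0 : X → ℝ)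
    (s : ℕ) (h : X → ℝ) : ℝ :=
  (∫ x, (d0 x * g 0 x) ^ 2 * (Lop ν q g 0 s x h) ^ 2 ∂ρ₀) /
    (∫ x, g 0 x * Lop ν q g 0 s x (fun _ => 1) ∂χ) ^ 2

/-- `V_{χ,r,s}[h]` for `1 ≤ r ≤ s`. -/
def Vr (ν χ : Measure X) (q : X → X → ℝ) (g : ℕ → X → ℝ)
    (ϑ : ℕ → X → ℝ) (p : ℕ → X → X → ℝ) (r s : ℕ) (h : X → ℝ) : ℝ :=
  philt ν χ q g (r - 1)
      (fun x => ϑ r x * ∫ y, p r x y * omegaFn q g ϑ p r x y ^ 2 * Lop ν q g r s y h ^ 2 ∂ν) *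
    philt ν χ q g (r - 1) (ϑ r) /
      phipred ν χ q g r (fun x => g r x * Lop ν q g r s x fun _ => 1) ^ 2

/-- `V_{χ,r,s}[h]` for `0 ≤ r ≤ s`. -/
def Vrs (ν ρ₀ χ : Measure X) (q : X → X → ℝ) (g : ℕ → X → ℝ) (d0 : X → ℝ)
    (ϑ : ℕ → X → ℝ) (p : ℕ → X → X → ℝ) (r s : ℕ) (h : X → ℝ) : ℝ :=
  if r = 0 then V0 ν ρ₀ χ q g d0 s h else Vr ν χ q g ϑ p r s h

/-- `‖ω_r‖_∞`, with the convention `ω₀ = (dχ/dρ₀)·g₀`. -/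
def supOmega (q : X → X → ℝ) (g : ℕ → X → ℝ) (d0 : X → ℝ)
    (ϑ : ℕ → X → ℝ) (p : ℕ → X → X → ℝ) (r : ℕ) : ℝ :=
  if r = 0 then ⨆ x, |d0 x * g 0 x| else ⨆ pr : X × X, |omegaFn q g ϑ p r pr.1 pr.2|

/-- `‖ϑ_r‖_∞`, with the convention `ϑ₀ ≡ 1`. -/
def supTheta (ϑ : ℕ → X → ℝ) (r : ℕ) : ℝ :=
  if r = 0 then 1 else ⨆ x, |ϑ r x|

/-- marginal smoothing distribution `φ_{s|T}(h)`. -/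
def phismooth (ν χ : Measure X) (q : X → X → ℝ) (g : ℕ → X → ℝ) (s T : ℕ) (h : X → ℝ) : ℝ :=
  philt ν χ q g s (fun x => h x * Lop ν q g s T x fun _ => 1) /
    philt ν χ q g s (fun x => Lop ν q g s T x fun _ => 1)

/-- unnormalized joint smoothing functional of the states at times `s` and `t1` (`s ≤ t1`). -/
def jointNum (ν χ : Measure X) (q : X → X → ℝ) (g : ℕ → X → ℝ) (s t1 : ℕ)
    (ψ : X → X → ℝ) : ℝ :=
  ∫ x0, g 0 x0 * ∫ xs, ellST ν q g 0 s x0 xs *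
    (if s < t1 then ∫ y, ellST ν q g s t1 xs y * ψ xs y ∂ν else ψ xs xs) ∂ν ∂χ

/-- joint smoothing distribution `φ_{s,t1|t1}(ψ)` (`s ≤ t1`). -/
def jointSm (ν χ : Measure X) (q : X → X → ℝ) (g : ℕ → X → ℝ) (s t1 : ℕ)
    (ψ : X → X → ℝ) : ℝ :=
  jointNum ν χ q g s t1 ψ / jointNum ν χ q g s t1 fun _ _ => 1

/-- `g_{s,t,T}(x')`. -/
def gstT (ν χ : Measure X) (q : X → X → ℝ) (g : ℕ → X → ℝ) (h : X → ℝ)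
    (s t T : ℕ) (x' : X) : ℝ :=
  jointSm ν χ q g s (t - 1) (fun xs y => h xs * q y x') * Lop ν q g t T x' (fun _ => 1) /
    philt ν χ q g (t - 1) (fun x => q x x')

/-- `υ_{s,t,T}(x) = ϑ_t(x) ∫ p_t(x,x') ω_t(x,x')² g_{s,t,T}(x')² ν(dx')`. -/
def upsilon (ν χ : Measure X) (q : X → X → ℝ) (g : ℕ → X → ℝ)
    (ϑ : ℕ → X → ℝ) (p : ℕ → X → X → ℝ) (h : X → ℝ) (s t T : ℕ) (x : X) : ℝ :=
  ϑ t x * ∫ x', p t x x' * omegaFn q g ϑ p t x x' ^ 2 * gstT ν χ q g h s t T x' ^ 2 ∂ν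

end

section Helpers

/-- Bounded measurable real functions. -/
structure BddMeas {Y : Type*} [MeasurableSpace Y] (f : Y → ℝ) : Prop where
  meas : Measurable f
  bdd : ∃ C, ∀ y, |f y| ≤ C

namespace BddMeas

variable {Y Z : Type*} [MeasurableSpace Y] [MeasurableSpace Z]

lemma const (c : ℝ) : BddMeas (fun _ : Y => c) := ⟨measurable_const, |c|, fun _ => le_rfl⟩

lemma mul {f k : Y → ℝ} (hf : BddMeas f) (hk : BddMeas k) : BddMeas (fun y => f y * k y) := by
  obtain ⟨C, hC⟩ := hf.bdd
  obtain ⟨D, hD⟩ := hk.bdd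
  refine ⟨hf.meas.mul hk.meas, C * D, fun y => ?_⟩
  rw [abs_mul]
  exact mul_le_mul (hC y) (hD y) (abs_nonneg _) ((abs_nonneg _).trans (hC y))

lemma comp {f : Y → ℝ} (hf : BddMeas f) {k : Z → Y} (hk : Measurable k) :
    BddMeas (fun z => f (k z)) :=
  ⟨hf.meas.comp hk, hf.bdd.imp fun _ hC z => hC (k z)⟩

lemma integrable {f : Y → ℝ} (hf : BddMeas f) (μ : Measure Y) [IsFiniteMeasure μ] :
    Integrable f μ := by
  obtain ⟨C, hC⟩ := hf.bdd
  exact Integrable.of_bound hf.meas.aestronglyMeasurable C (Filter.Eventually.of_forall hC)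

lemma integral {f : Y → Z → ℝ} (hf : BddMeas fun pr : Y × Z => f pr.1 pr.2)
    (μ : Measure Z) [IsFiniteMeasure μ] : BddMeas (fun y => ∫ z, f y z ∂μ) := by
  obtain ⟨C, hC⟩ := hf.bdd
  refine ⟨(hf.meas.stronglyMeasurable.integral_prod_right (ν := μ)).measurable,
    C * μ.real Set.univ, fun y => ?_⟩
  rw [← Real.norm_eq_abs]
  exact norm_integral_le_of_norm_le_const (Filter.Eventually.of_forall fun z => hC (y, z))

lemma integral_swap {f : Y → Z → ℝ} (hf : BddMeas fun pr : Y × Z => f pr.1 pr.2)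
    (μ : Measure Y) (ν : Measure Z) [IsFiniteMeasure μ] [IsFiniteMeasure ν] :
    ∫ y, ∫ z, f y z ∂ν ∂μ = ∫ z, ∫ y, f y z ∂μ ∂ν :=
  integral_integral_swap (hf.integrable (μ.prod ν))

end BddMeas

lemma abs_le_of_ratio_bounds {Y : Type*} {N D : Y → ℝ} {a b δ : ℝ} (hab : b - a ≤ δ) (ha0 : a ≤ 0)
    (hb0 : 0 ≤ b) (hD : ∀ x, 0 ≤ D x) (ha : ∀ x, a * D x ≤ N x) (hb : ∀ x, N x ≤ b * D x)
    (x : Y) : |N x| ≤ δ * D x := by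
  have h1 := ha x
  have h2 := hb x
  have h3 := mul_le_mul_of_nonneg_right (show b ≤ δ by linarith) (hD x)
  have h4 := mul_le_mul_of_nonneg_right (show -δ ≤ a by linarith) (hD x)
  exact abs_le.2 ⟨by linarith, by linarith⟩

variable {X : Type*} [MeasurableSpace X]

/-- The operator `f ↦ ∫ q(x,y) k(y) f(y) ν(dy)`. -/
noncomputable def kop (ν : Measure X) (q : X → X → ℝ) (k f : X → ℝ) (x : X) : ℝ :=
  ∫ y, q x y * k y * f y ∂ν

lemma BddMeas.kop {ν : Measure X} [IsFiniteMeasure ν] {q : X → X → ℝ} {k f : X → ℝ}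
    (hq : BddMeas fun pr : X × X => q pr.1 pr.2) (hk : BddMeas k) (hf : BddMeas f) :
    BddMeas (kop ν q k f) :=
  BddMeas.integral (f := fun x y => q x y * k y * f y)
    ((hq.mul (hk.comp measurable_snd)).mul (hf.comp measurable_snd)) ν

/-- A kernel with density in `[σm, σp]` contracts by `1 - σm / σp` any interval containing the
ratio of two functions. -/
lemma kop_ratio_contract {ν : Measure X} [IsFiniteMeasure ν] {σm σp : ℝ} (hσm : 0 < σm)
    (hσmp : σm ≤ σp) {q : X → X → ℝ} (hqb : BddMeas fun pr : X × X => q pr.1 pr.2)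
    (hq : ∀ x y, σm ≤ q x y ∧ q x y ≤ σp) {k N D : X → ℝ}
    (hk : BddMeas k) (hN : BddMeas N) (hD : BddMeas D) (hk0 : ∀ x, 0 ≤ k x) (hD0 : ∀ x, 0 ≤ D x)
    {a b : ℝ} (ha : ∀ x, a * D x ≤ N x) (hb : ∀ x, N x ≤ b * D x) (hab : a ≤ b) :
    ∃ a' b', a' ≤ b' ∧ b' - a' ≤ (1 - σm / σp) * (b - a) ∧
      (∀ x, a' * kop ν q k D x ≤ kop ν q k N x) ∧
      (∀ x, kop ν q k N x ≤ b' * kop ν q k D x) := by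
  have hσp : 0 < σp := hσm.trans_le hσmp
  have hε1 : σm / σp ≤ 1 := (div_le_one hσp).2 hσmp
  have hε0 : 0 < σm / σp := div_pos hσm hσp
  have iqk : ∀ x {f : X → ℝ}, BddMeas f → Integrable (fun y => q x y * k y * f y) ν :=
    fun x f hf => (((hqb.comp (measurable_prodMk_left (x := x))).mul hk).mul hf).integrable ν
  have ik : ∀ {f : X → ℝ}, BddMeas f → Integrable (fun y => k y * f y) ν :=
    fun hf => (hk.mul hf).integrable ν
  set I := ∫ y, k y * D y ∂ν with hI
  set J := ∫ y, k y * N y ∂ν with hJ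
  have hI0 : 0 ≤ I := integral_nonneg fun y => mul_nonneg (hk0 y) (hD0 y)
  have hPD0 : ∀ x, 0 ≤ kop ν q k D x := fun x =>
    integral_nonneg fun y => mul_nonneg (mul_nonneg (hσm.le.trans (hq x y).1) (hk0 y)) (hD0 y)
  have hPDI : ∀ x, kop ν q k D x ≤ σp * I := by
    intro x
    rw [hI, ← integral_const_mul]
    refine integral_mono (iqk x hD) ((ik hD).const_mul _) fun y => ?_
    have := mul_le_mul_of_nonneg_right (hq x y).2 (mul_nonneg (hk0 y) (hD0 y))
    simp only; linarith
  have hlow : ∀ x, σm * (J - a * I) ≤ kop ν q k N x - a * kop ν q k D x := by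
    intro x
    rw [hI, hJ, kop, kop, ← integral_const_mul, ← integral_const_mul,
      ← integral_sub (ik hN) ((ik hD).const_mul _),
      ← integral_sub (iqk x hN) ((iqk x hD).const_mul _), ← integral_const_mul]
    refine integral_mono (((ik hN).sub ((ik hD).const_mul _)).const_mul _)
      ((iqk x hN).sub ((iqk x hD).const_mul _)) fun y => ?_
    have := mul_le_mul_of_nonneg_right (hq x y).1
      (mul_nonneg (hk0 y) (sub_nonneg.2 (ha y)))
    simp only; linarith
  have hup : ∀ x, σm * (b * I - J) ≤ b * kop ν q k D x - kop ν q k N x := by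
    intro x
    rw [hI, hJ, kop, kop, ← integral_const_mul, ← integral_const_mul,
      ← integral_sub ((ik hD).const_mul _) (ik hN),
      ← integral_sub ((iqk x hD).const_mul _) (iqk x hN), ← integral_const_mul]
    refine integral_mono ((((ik hD).const_mul _).sub (ik hN)).const_mul _)
      (((iqk x hD).const_mul _).sub (iqk x hN)) fun y => ?_
    have := mul_le_mul_of_nonneg_right (hq x y).1
      (mul_nonneg (hk0 y) (sub_nonneg.2 (hb y)))
    simp only; linarith
  have haJ : a * I ≤ J := by
    rw [hI, hJ, ← integral_const_mul]
    refine integral_mono ((ik hD).const_mul _) (ik hN) fun y => ?_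
    have := mul_le_mul_of_nonneg_left (ha y) (hk0 y)
    simp only; linarith
  have hbJ : J ≤ b * I := by
    rw [hI, hJ, ← integral_const_mul]
    refine integral_mono (ik hN) ((ik hD).const_mul _) fun y => ?_
    have := mul_le_mul_of_nonneg_left (hb y) (hk0 y)
    simp only; linarith
  rcases hI0.eq_or_lt with hz | hpos
  · have hPD : ∀ x, kop ν q k D x = 0 := fun x =>
      le_antisymm (by simpa [← hz] using hPDI x) (hPD0 x)
    have hJz : J = 0 := le_antisymm (by simpa [← hz] using hbJ) (by simpa [← hz] using haJ)
    refine ⟨a, a, le_rfl, ?_, fun x => ?_, fun x => ?_⟩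
    · rw [sub_self]; exact mul_nonneg (by linarith) (by linarith)
    · have := hlow x; rw [hPD x, ← hz, hJz] at *; linarith
    · have := hup x; rw [hPD x, ← hz, hJz] at *; linarith
  · obtain ⟨c, hc⟩ : ∃ c, J = c * I := ⟨J / I, by field_simp⟩
    have hac : a ≤ c := by rw [hc] at haJ; exact le_of_mul_le_mul_right haJ hpos
    have hcb : c ≤ b := by rw [hc] at hbJ; exact le_of_mul_le_mul_right hbJ hpos
    have hle : ∀ x, σm / σp * kop ν q k D x ≤ σm * I := fun x => by
      calc σm / σp * kop ν q k D x ≤ σm / σp * (σp * I) :=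
            mul_le_mul_of_nonneg_left (hPDI x) hε0.le
        _ = σm * I := by field_simp
    refine ⟨σm / σp * c + (1 - σm / σp) * a, σm / σp * c + (1 - σm / σp) * b, ?_, ?_,
      fun x => ?_, fun x => ?_⟩
    · have := mul_le_mul_of_nonneg_left hab (sub_nonneg.2 hε1); linarith
    · linarith
    · have h1 := hlow x
      have h2 := mul_le_mul_of_nonneg_right (hle x) (sub_nonneg.2 hac)
      rw [hc] at h1; linarith
    · have h1 := hup x
      have h2 := mul_le_mul_of_nonneg_right (hle x) (sub_nonneg.2 hcb)
      rw [hc] at h1; linarith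

lemma ell_bddMeas {ν : Measure X} [IsFiniteMeasure ν] {q : X → X → ℝ} {g : ℕ → X → ℝ}
    (hq : BddMeas fun pr : X × X => q pr.1 pr.2) (hg : ∀ t, BddMeas (g t)) (s n : ℕ) :
    BddMeas fun pr : X × X => ell ν q g s n pr.1 pr.2 := by
  induction n with
  | zero => exact hq.mul ((hg _).comp measurable_snd)
  | succ n ih =>
    refine BddMeas.integral (Y := X × X)
      (f := fun pr z => ell ν q g s n pr.1 z * (q z pr.2 * g (s + n + 2) pr.2)) ?_ ν
    refine (ih.comp (k := fun w : (X × X) × X => (w.1.1, w.2)) (by fun_prop)).mul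
      ((hq.comp (k := fun w : (X × X) × X => (w.2, w.1.2)) (by fun_prop)).mul
        ((hg _).comp (k := fun w : (X × X) × X => w.1.2) (by fun_prop)))

lemma Lop_self (ν : Measure X) (q : X → X → ℝ) (g : ℕ → X → ℝ) (t : ℕ) (x : X) (f : X → ℝ) :
    Lop ν q g t t x f = f x := by simp [Lop]

lemma Lop_succ_right {ν : Measure X} [IsFiniteMeasure ν] {q : X → X → ℝ} {g : ℕ → X → ℝ}
    (hq : BddMeas fun pr : X × X => q pr.1 pr.2) (hg : ∀ t, BddMeas (g t)) {s t : ℕ}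
    (hst : s ≤ t) {f : X → ℝ} (hf : BddMeas f) (x : X) :
    Lop ν q g s (t + 1) x f = Lop ν q g s t x (kop ν q (g (t + 1)) f) := by
  rcases hst.eq_or_lt with rfl | hlt
  · simp [Lop, ellST, ell, kop]
  · obtain ⟨n, rfl⟩ := Nat.exists_eq_add_of_lt hlt
    have e1 : s + n + 1 + 1 - s - 1 = n + 1 := by lia
    have e2 : s + n + 1 - s - 1 = n := by lia
    simp only [Lop, ellST, hlt, show s < s + n + 1 + 1 by lia, if_true, e1, e2, ell, kop]
    have hB : BddMeas fun pr : X × X =>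
        ell ν q g s n x pr.2 * (q pr.2 pr.1 * g (s + n + 2) pr.1) * f pr.1 :=
      (((ell_bddMeas hq hg s n).comp (k := fun w : X × X => (x, w.2)) (by fun_prop)).mul
        ((hq.comp measurable_swap).mul ((hg _).comp measurable_fst))).mul
        (hf.comp measurable_fst)
    simp_rw [← integral_mul_const]
    rw [BddMeas.integral_swap
      (f := fun y z => ell ν q g s n x z * (q z y * g (s + n + 2) y) * f y) hB]
    refine integral_congr_ae (Filter.Eventually.of_forall fun z => ?_)
    simp only [← integral_const_mul]
    refine integral_congr_ae (Filter.Eventually.of_forall fun y => ?_)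
    simp only; ring

lemma Lop_bddMeas {ν : Measure X} [IsFiniteMeasure ν] {q : X → X → ℝ} {g : ℕ → X → ℝ}
    (hq : BddMeas fun pr : X × X => q pr.1 pr.2) (hg : ∀ t, BddMeas (g t)) (s t : ℕ)
    {f : X → ℝ} (hf : BddMeas f) : BddMeas fun x => Lop ν q g s t x f := by
  by_cases hst : s < t
  · simp only [Lop, hst, if_true]
    exact BddMeas.integral (f := fun x y => ellST ν q g s t x y * f y)
      ((ell_bddMeas hq hg s _).mul (hf.comp measurable_snd)) ν
  · simpa only [Lop, hst, if_false] using hf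

lemma Lop_comp {ν : Measure X} [IsFiniteMeasure ν] {q : X → X → ℝ} {g : ℕ → X → ℝ}
    (hq : BddMeas fun pr : X × X => q pr.1 pr.2) (hg : ∀ t, BddMeas (g t)) {s t u : ℕ}
    (hst : s ≤ t) (htu : t ≤ u) {f : X → ℝ} (hf : BddMeas f) (x : X) :
    Lop ν q g s t x (fun y => Lop ν q g t u y f) = Lop ν q g s u x f := by
  induction u, htu using Nat.le_induction generalizing f with
  | base => simp [Lop_self]
  | succ u htu ih =>
    simp_rw [Lop_succ_right hq hg htu hf, Lop_succ_right hq hg (hst.trans htu) hf]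
    exact ih (BddMeas.kop hq (hg _) hf)

lemma Lop_succ_left {ν : Measure X} [IsFiniteMeasure ν] {q : X → X → ℝ} {g : ℕ → X → ℝ}
    (hq : BddMeas fun pr : X × X => q pr.1 pr.2) (hg : ∀ t, BddMeas (g t)) {s t : ℕ}
    (hst : s < t) {f : X → ℝ} (hf : BddMeas f) (x : X) :
    Lop ν q g s t x f = kop ν q (g (s + 1)) (fun y => Lop ν q g (s + 1) t y f) x := by
  rw [← Lop_comp hq hg (Nat.le_succ s) hst hf,
    Lop_succ_right hq hg le_rfl (Lop_bddMeas hq hg _ _ hf), Lop_self]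

/-- The standing assumptions on the state space model. -/
structure MixingModel (ν χ : Measure X) (q : X → X → ℝ) (g : ℕ → X → ℝ) (σm σp cm : ℝ) :
    Prop where
  probν : IsProbabilityMeasure ν
  probχ : IsProbabilityMeasure χ
  σm_pos : 0 < σm
  σm_le : σm ≤ σp
  cm_pos : 0 < cm
  q_bdd : BddMeas fun pr : X × X => q pr.1 pr.2
  q_mem : ∀ x y, σm ≤ q x y ∧ q x y ≤ σp
  g_bdd : ∀ t, BddMeas (g t)
  g_nonneg : ∀ t x, 0 ≤ g t x
  init_ge : cm ≤ ∫ x, g 0 x ∂χ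
  step_ge : ∀ t, 1 ≤ t → ∀ x, cm ≤ ∫ y, q x y * g t y ∂ν

/-- The unnormalized filter `f ↦ χ(g₀ L_{0,t}(·, f))`. -/
noncomputable def unnormFilter (ν χ : Measure X) (q : X → X → ℝ) (g : ℕ → X → ℝ) (t : ℕ)
    (f : X → ℝ) : ℝ :=
  ∫ x, g 0 x * Lop ν q g 0 t x f ∂χ

/-- The unnormalized predictive density at time `n + 1` with respect to `ν`. -/
noncomputable def predDensity (ν χ : Measure X) (q : X → X → ℝ) (g : ℕ → X → ℝ) :
    ℕ → X → ℝ
  | 0 => fun y => ∫ x, g 0 x * q x y ∂χ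
  | n + 1 => kop ν (fun y x => q x y) (g (n + 1)) (predDensity ν χ q g n)

/-- The density at time `m + 1 + n` obtained by propagating the unnormalized predictive density
at time `m + 1` weighted by `h`. -/
noncomputable def weightedDensity (ν χ : Measure X) (q : X → X → ℝ) (g : ℕ → X → ℝ)
    (h : X → ℝ) (m : ℕ) : ℕ → X → ℝ
  | 0 => fun y => h y * predDensity ν χ q g m y
  | n + 1 => kop ν (fun y x => q x y) (g (m + 1 + n)) (weightedDensity ν χ q g h m n)

lemma Lop_const_mul (ν : Measure X) (q : X → X → ℝ) (g : ℕ → X → ℝ) (s t : ℕ)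
    (c : ℝ) (f : X → ℝ) (x : X) :
    Lop ν q g s t x (fun y => c * f y) = c * Lop ν q g s t x f := by
  unfold Lop
  split_ifs
  · rw [← integral_const_mul]; congr 1; ext y; ring
  · rfl

lemma unnormFilter_const_mul (ν χ : Measure X) (q : X → X → ℝ) (g : ℕ → X → ℝ) (t : ℕ)
    (c : ℝ) (f : X → ℝ) :
    unnormFilter ν χ q g t (fun y => c * f y) = c * unnormFilter ν χ q g t f := by
  simp only [unnormFilter, Lop_const_mul, ← integral_const_mul]
  congr 1; ext x; ring

lemma jointNum_eq (ν χ : Measure X) (q : X → X → ℝ) (g : ℕ → X → ℝ) {s n : ℕ} (hs : 1 ≤ s)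
    (ψ : X → X → ℝ) :
    jointNum ν χ q g s (s + n) ψ =
      unnormFilter ν χ q g s (fun x => Lop ν q g s (s + n) x (ψ x)) := by
  simp only [jointNum, unnormFilter, Lop, show 0 < s from hs, if_true]

lemma philt_eq (ν χ : Measure X) (q : X → X → ℝ) (g : ℕ → X → ℝ) (t : ℕ) (f : X → ℝ) :
    philt ν χ q g t f = unnormFilter ν χ q g t f / unnormFilter ν χ q g t fun _ => 1 := rfl

namespace MixingModel

variable {ν χ : Measure X} {q : X → X → ℝ} {g : ℕ → X → ℝ} {σm σp cm : ℝ}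

lemma Lop_bdd (M : MixingModel ν χ q g σm σp cm)
    (s t : ℕ) {f : X → ℝ} (hf : BddMeas f) : BddMeas fun x => Lop ν q g s t x f :=
  have := M.probν
  Lop_bddMeas M.q_bdd M.g_bdd s t hf

lemma kop_bdd (M : MixingModel ν χ q g σm σp cm)
    (t : ℕ) {f : X → ℝ} (hf : BddMeas f) : BddMeas (kop ν q (g t) f) :=
  have := M.probν
  BddMeas.kop M.q_bdd (M.g_bdd t) hf

lemma q_swap_bdd (M : MixingModel ν χ q g σm σp cm)
    : BddMeas fun pr : X × X => q pr.2 pr.1 := M.q_bdd.comp measurable_swap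

lemma q_left_bdd (M : MixingModel ν χ q g σm σp cm) (y : X) : BddMeas fun x => q x y :=
  M.q_bdd.comp (k := fun x => (x, y)) (by fun_prop)

lemma q_right_bdd (M : MixingModel ν χ q g σm σp cm) (x : X) : BddMeas fun y => q x y :=
  M.q_bdd.comp (k := fun y => (x, y)) (by fun_prop)

lemma q_nonneg (M : MixingModel ν χ q g σm σp cm)
    (x y : X) : 0 ≤ q x y := M.σm_pos.le.trans (M.q_mem x y).1

lemma kop_mono (M : MixingModel ν χ q g σm σp cm)
    (t : ℕ) {f k : X → ℝ} (hf : BddMeas f) (hk : BddMeas k) (hfk : ∀ x, f x ≤ k x)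
    (x : X) : kop ν q (g t) f x ≤ kop ν q (g t) k x := by
  have := M.probν
  have hqg := (M.q_right_bdd x).mul (M.g_bdd t)
  exact integral_mono ((hqg.mul hf).integrable ν) ((hqg.mul hk).integrable ν) fun y =>
    mul_le_mul_of_nonneg_left (hfk y) (mul_nonneg (M.q_nonneg x y) (M.g_nonneg t y))

lemma Lop_mono (M : MixingModel ν χ q g σm σp cm)
    {s t : ℕ} (hst : s ≤ t) {f k : X → ℝ} (hf : BddMeas f) (hk : BddMeas k)
    (hfk : ∀ x, f x ≤ k x) (x : X) : Lop ν q g s t x f ≤ Lop ν q g s t x k := by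
  have := M.probν
  induction t, hst using Nat.le_induction generalizing f k with
  | base => simpa [Lop_self] using hfk x
  | succ t hst ih =>
    rw [Lop_succ_right M.q_bdd M.g_bdd hst hf, Lop_succ_right M.q_bdd M.g_bdd hst hk]
    exact ih (M.kop_bdd _ hf) (M.kop_bdd _ hk) (M.kop_mono _ hf hk hfk)

lemma unnormFilter_mono (M : MixingModel ν χ q g σm σp cm)
    (t : ℕ) {f k : X → ℝ} (hf : BddMeas f) (hk : BddMeas k)
    (hfk : ∀ x, f x ≤ k x) : unnormFilter ν χ q g t f ≤ unnormFilter ν χ q g t k := by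
  have := M.probχ
  exact integral_mono (((M.g_bdd 0).mul (M.Lop_bdd 0 t hf)).integrable χ)
    (((M.g_bdd 0).mul (M.Lop_bdd 0 t hk)).integrable χ) fun x =>
    mul_le_mul_of_nonneg_left (M.Lop_mono (Nat.zero_le t) hf hk hfk x) (M.g_nonneg 0 x)

lemma unnormFilter_succ (M : MixingModel ν χ q g σm σp cm) (t : ℕ) {f : X → ℝ} (hf : BddMeas f) :
    unnormFilter ν χ q g (t + 1) f = unnormFilter ν χ q g t (kop ν q (g (t + 1)) f) := by
  have := M.probν
  simp only [unnormFilter, Lop_succ_right M.q_bdd M.g_bdd (Nat.zero_le t) hf]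

lemma unnormFilter_Lop (M : MixingModel ν χ q g σm σp cm)
    {s t : ℕ} (hst : s ≤ t) {f : X → ℝ} (hf : BddMeas f) :
    unnormFilter ν χ q g s (fun y => Lop ν q g s t y f) = unnormFilter ν χ q g t f := by
  have := M.probν
  simp only [unnormFilter, Lop_comp M.q_bdd M.g_bdd (Nat.zero_le s) hst hf]

lemma unnormFilter_one_pos (M : MixingModel ν χ q g σm σp cm)
    (t : ℕ) : 0 < unnormFilter ν χ q g t fun _ => 1 := by
  induction t with
  | zero => simpa [unnormFilter, Lop_self] using M.cm_pos.trans_le M.init_ge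
  | succ t ih =>
    rw [M.unnormFilter_succ t (BddMeas.const 1)]
    have h1 := M.unnormFilter_mono t (f := fun _ => cm * 1) (k := kop ν q (g (t + 1)) fun _ => 1)
      (BddMeas.const _) (M.kop_bdd _ (BddMeas.const 1))
      (fun x => by simpa [kop] using M.step_ge (t + 1) (by lia) x)
    rw [unnormFilter_const_mul ν χ q g t cm (fun _ => 1)] at h1
    exact (mul_pos M.cm_pos ih).trans_le h1

lemma Lop_one_nonneg (M : MixingModel ν χ q g σm σp cm)
    {s t : ℕ} (hst : s ≤ t) (x : X) : 0 ≤ Lop ν q g s t x fun _ => 1 := by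
  have h1 := M.Lop_mono hst (BddMeas.const 0) (BddMeas.const 1) (fun _ => zero_le_one) x
  have h2 := Lop_const_mul ν q g s t 0 (fun _ => 1) x
  simp only [zero_mul] at h2
  rwa [h2] at h1

/-- The ratio of the values of `L_{s,t}(·, 1)` is at most `σp / σm`. -/
lemma exists_Lop_one_bounds (M : MixingModel ν χ q g σm σp cm) {s t : ℕ} (hst : s ≤ t) :
    ∃ a, ∀ x, σm * a ≤ (Lop ν q g s t x fun _ => 1) ∧ (Lop ν q g s t x fun _ => 1) ≤ σp * a := by
  have := M.probν
  have hσp : 0 < σp := M.σm_pos.trans_le M.σm_le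
  rcases hst.eq_or_lt with rfl | hlt
  · refine ⟨1 / σp, fun x => ?_⟩
    rw [Lop_self, mul_one_div, mul_one_div, div_self hσp.ne']
    exact ⟨(div_le_one hσp).2 M.σm_le, le_rfl⟩
  · have hL := M.Lop_bdd (s + 1) t (BddMeas.const 1)
    have hgL := (M.g_bdd (s + 1)).mul hL
    refine ⟨∫ y, g (s + 1) y * Lop ν q g (s + 1) t y (fun _ => 1) ∂ν, fun x => ?_⟩
    rw [Lop_succ_left M.q_bdd M.g_bdd hlt (BddMeas.const 1), kop, ← integral_const_mul,
      ← integral_const_mul]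
    have hi := (((M.q_right_bdd x).mul (M.g_bdd (s + 1))).mul hL).integrable ν
    have h0 := fun y => mul_nonneg (M.g_nonneg (s + 1) y) (M.Lop_one_nonneg hlt y)
    constructor
    · refine integral_mono ((hgL.integrable ν).const_mul _) hi fun y => ?_
      have := mul_le_mul_of_nonneg_right (M.q_mem x y).1 (h0 y)
      simpa only [mul_assoc] using this
    · refine integral_mono hi ((hgL.integrable ν).const_mul _) fun y => ?_
      have := mul_le_mul_of_nonneg_right (M.q_mem x y).2 (h0 y)
      simpa only [mul_assoc] using this

lemma predDensity_bdd (M : MixingModel ν χ q g σm σp cm)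
    (n : ℕ) : BddMeas (predDensity ν χ q g n) := by
  have := M.probν
  have := M.probχ
  induction n with
  | zero =>
    exact BddMeas.integral (f := fun y x => g 0 x * q x y)
      (((M.g_bdd 0).comp measurable_snd).mul M.q_swap_bdd) χ
  | succ n ih => exact BddMeas.kop M.q_swap_bdd (M.g_bdd _) ih

lemma weightedDensity_bdd (M : MixingModel ν χ q g σm σp cm)
    {h : X → ℝ} (hh : BddMeas h) (m n : ℕ) :
    BddMeas (weightedDensity ν χ q g h m n) := by
  have := M.probν
  induction n with
  | zero => exact hh.mul (M.predDensity_bdd m)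
  | succ n ih => exact BddMeas.kop M.q_swap_bdd (M.g_bdd _) ih

/-- The two operators attached to `q` and to its transpose are adjoint. -/
lemma integral_mul_kop (M : MixingModel ν χ q g σm σp cm)
    {a k k' f : X → ℝ} (ha : BddMeas a) (hk : BddMeas k) (hk' : BddMeas k')
    (hf : BddMeas f) :
    ∫ x, a x * (k x * kop ν q k' f x) ∂ν =
      ∫ y, kop ν (fun y x => q x y) k a y * (k' y * f y) ∂ν := by
  have := M.probν
  simp only [kop, ← integral_const_mul, ← integral_mul_const]
  rw [BddMeas.integral_swap (f := fun x y => a x * (k x * (q x y * k' y * f y)))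
    ((ha.comp measurable_fst).mul ((hk.comp measurable_fst).mul
      ((M.q_bdd.mul (hk'.comp measurable_snd)).mul (hf.comp measurable_snd))))]
  congr 1; ext y; congr 1; ext x; ring

lemma unnormFilter_succ_eq (M : MixingModel ν χ q g σm σp cm) (n : ℕ) {f : X → ℝ} (hf : BddMeas f) :
    unnormFilter ν χ q g (n + 1) f = ∫ y, predDensity ν χ q g n y * (g (n + 1) y * f y) ∂ν := by
  have := M.probν
  have := M.probχ
  induction n generalizing f with
  | zero =>
    rw [M.unnormFilter_succ 0 hf]
    simp only [unnormFilter, Lop_self, kop, predDensity, ← integral_const_mul,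
      ← integral_mul_const]
    rw [BddMeas.integral_swap (f := fun x y => g 0 x * (q x y * g (0 + 1) y * f y))
      (((M.g_bdd 0).comp measurable_fst).mul
        ((M.q_bdd.mul ((M.g_bdd _).comp measurable_snd)).mul (hf.comp measurable_snd)))]
    congr 1; ext y; congr 1; ext x; ring
  | succ n ih =>
    rw [M.unnormFilter_succ (n + 1) hf, ih (M.kop_bdd _ hf),
      M.integral_mul_kop (M.predDensity_bdd n) (M.g_bdd _) (M.g_bdd _) hf]
    rfl

lemma unnormFilter_q (M : MixingModel ν χ q g σm σp cm) (n : ℕ) (y : X) :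
    unnormFilter ν χ q g n (fun x => q x y) = predDensity ν χ q g n y := by
  cases n with
  | zero => simp [unnormFilter, Lop_self, predDensity]
  | succ n =>
    rw [M.unnormFilter_succ_eq n (M.q_left_bdd y)]
    simp only [predDensity, kop]
    congr 1; ext x; ring

lemma predDensity_pos (M : MixingModel ν χ q g σm σp cm)
    (n : ℕ) (y : X) : 0 < predDensity ν χ q g n y := by
  rw [← M.unnormFilter_q]
  have h1 := M.unnormFilter_mono n (f := fun _ => σm * 1) (BddMeas.const _) (M.q_left_bdd y)
    (fun x => by simpa using (M.q_mem x y).1)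
  rw [unnormFilter_const_mul ν χ q g n σm (fun _ => 1)] at h1
  exact (mul_pos M.σm_pos (M.unnormFilter_one_pos n)).trans_le h1

lemma unnormFilter_mul_Lop (M : MixingModel ν χ q g σm σp cm)
    {h : X → ℝ} (hh : BddMeas h) (m n : ℕ) {f : X → ℝ}
    (hf : BddMeas f) :
    unnormFilter ν χ q g (m + 1) (fun x => h x * Lop ν q g (m + 1) (m + 1 + n) x f) =
      ∫ y, weightedDensity ν χ q g h m n y * (g (m + 1 + n) y * f y) ∂ν := by
  have := M.probν
  induction n generalizing f with
  | zero =>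
    simp only [Nat.add_zero, Lop_self, weightedDensity]
    rw [M.unnormFilter_succ_eq m (hh.mul hf)]
    congr 1; ext y; ring
  | succ n ih =>
    rw [← Nat.add_assoc]
    simp only [Lop_succ_right M.q_bdd M.g_bdd (Nat.le_add_right (m + 1) n) hf]
    rw [ih (M.kop_bdd _ hf),
      M.integral_mul_kop (M.weightedDensity_bdd hh m n) (M.g_bdd _) (M.g_bdd _) hf]
    rfl

lemma jointNum_mul_q (M : MixingModel ν χ q g σm σp cm)
    {h : X → ℝ} (hh : BddMeas h) (m n : ℕ) (x' : X) :
    jointNum ν χ q g (m + 1) (m + 1 + n) (fun xs y => h xs * q y x') =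
      weightedDensity ν χ q g h m (n + 1) x' := by
  rw [jointNum_eq ν χ q g (by lia)]
  simp only [Lop_const_mul]
  rw [M.unnormFilter_mul_Lop hh m n (M.q_left_bdd x')]
  simp only [weightedDensity, kop]
  congr 1; ext x; ring

lemma philt_Lop_one (M : MixingModel ν χ q g σm σp cm) {s t : ℕ} (hst : s ≤ t) :
    philt ν χ q g s (fun x => Lop ν q g s t x fun _ => 1) =
      (unnormFilter ν χ q g t fun _ => 1) / unnormFilter ν χ q g s fun _ => 1 := by
  rw [philt_eq, M.unnormFilter_Lop hst (BddMeas.const 1)]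

lemma phipred_Lop_one (M : MixingModel ν χ q g σm σp cm) {n t : ℕ} (hnt : n + 1 ≤ t) :
    phipred ν χ q g (n + 1) (fun x => g (n + 1) x * Lop ν q g (n + 1) t x fun _ => 1) =
      (unnormFilter ν χ q g t fun _ => 1) / unnormFilter ν χ q g n fun _ => 1 := by
  rw [← M.unnormFilter_Lop hnt (BddMeas.const 1),
    M.unnormFilter_succ n (M.Lop_bdd _ _ (BddMeas.const 1))]
  simp only [phipred, Nat.add_sub_cancel, philt_eq]
  congr 3; ext x; simp only [kop, mul_assoc]

/-- Forgetting of the backward kernels. -/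
lemma weightedDensity_ratio (M : MixingModel ν χ q g σm σp cm)
    {h : X → ℝ} (hh : BddMeas h) {a b : ℝ} (ha : ∀ x, a ≤ h x)
    (hb : ∀ x, h x ≤ b) (hab : a ≤ b) (m n : ℕ) :
    ∃ a' b', a' ≤ b' ∧ b' - a' ≤ (1 - σm / σp) ^ n * (b - a) ∧
      (∀ x, a' * predDensity ν χ q g (m + n) x ≤ weightedDensity ν χ q g h m n x) ∧
      (∀ x, weightedDensity ν χ q g h m n x ≤ b' * predDensity ν χ q g (m + n) x) := by
  have := M.probν
  induction n with
  | zero =>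
    exact ⟨a, b, hab, by simp,
      fun x => mul_le_mul_of_nonneg_right (ha x) (M.predDensity_pos m x).le,
      fun x => mul_le_mul_of_nonneg_right (hb x) (M.predDensity_pos m x).le⟩
  | succ n ih =>
    obtain ⟨a', b', hab', hd, ha', hb'⟩ := ih
    obtain ⟨a'', b'', hab'', hd', ha'', hb''⟩ := kop_ratio_contract (ν := ν) M.σm_pos M.σm_le
      M.q_swap_bdd (fun y x => M.q_mem x y) (M.g_bdd (m + 1 + n)) (M.weightedDensity_bdd hh m n)
      (M.predDensity_bdd (m + n)) (M.g_nonneg _) (fun x => (M.predDensity_pos _ x).le) ha' hb' hab'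
    have e : m + 1 + n = m + n + 1 := by lia
    refine ⟨a'', b'', hab'', hd'.trans ?_, ?_, ?_⟩
    · rw [pow_succ', mul_assoc]
      refine mul_le_mul_of_nonneg_left hd (sub_nonneg.2 ?_)
      exact (div_le_one (M.σm_pos.trans_le M.σm_le)).2 M.σm_le
    · intro x
      rw [← Nat.add_assoc]
      simpa only [weightedDensity, predDensity, e] using ha'' x
    · intro x
      rw [← Nat.add_assoc]
      simpa only [weightedDensity, predDensity, e] using hb'' x

/-- Forgetting of the forward smoothing kernels. -/
lemma Lop_ratio (M : MixingModel ν χ q g σm σp cm)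
    {h : X → ℝ} (hh : BddMeas h) {a b : ℝ} (ha : ∀ x, a ≤ h x)
    (hb : ∀ x, h x ≤ b) (hab : a ≤ b) {s T : ℕ} (hsT : s ≤ T) (n r : ℕ) (hr : r + n = s) :
    ∃ a' b', a' ≤ b' ∧ b' - a' ≤ (1 - σm / σp) ^ n * (b - a) ∧
      (∀ x, a' * Lop ν q g r T x (fun _ => 1) ≤
        Lop ν q g r s x fun y => h y * Lop ν q g s T y fun _ => 1) ∧
      (∀ x, Lop ν q g r s x (fun y => h y * Lop ν q g s T y fun _ => 1) ≤
        b' * Lop ν q g r T x fun _ => 1) := by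
  have := M.probν
  induction n generalizing r with
  | zero =>
    obtain rfl : r = s := hr
    simp only [Lop_self]
    exact ⟨a, b, hab, by simp,
      fun x => mul_le_mul_of_nonneg_right (ha x) (M.Lop_one_nonneg hsT x),
      fun x => mul_le_mul_of_nonneg_right (hb x) (M.Lop_one_nonneg hsT x)⟩
  | succ n ih =>
    obtain ⟨a', b', hab', hd, ha', hb'⟩ := ih (r + 1) (by lia)
    have hhL := hh.mul (M.Lop_bdd s T (BddMeas.const 1))
    obtain ⟨a'', b'', hab'', hd', ha'', hb''⟩ := kop_ratio_contract (ν := ν) M.σm_pos M.σm_le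
      M.q_bdd M.q_mem (M.g_bdd (r + 1)) (M.Lop_bdd (r + 1) s hhL)
      (M.Lop_bdd (r + 1) T (BddMeas.const 1)) (M.g_nonneg _)
      (fun x => M.Lop_one_nonneg (by lia) x) ha' hb' hab'
    simp only [Lop_succ_left M.q_bdd M.g_bdd (show r < T by lia) (BddMeas.const 1),
      Lop_succ_left M.q_bdd M.g_bdd (show r < s by lia) hhL]
    refine ⟨a'', b'', hab'', hd'.trans ?_, ha'', hb''⟩
    rw [pow_succ', mul_assoc]
    refine mul_le_mul_of_nonneg_left hd (sub_nonneg.2 ?_)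
    exact (div_le_one (M.σm_pos.trans_le M.σm_le)).2 M.σm_le

lemma abs_weightedDensity_le (M : MixingModel ν χ q g σm σp cm)
    {h : X → ℝ} (hh : BddMeas h) {a b : ℝ} (ha : ∀ x, a ≤ h x)
    (hb : ∀ x, h x ≤ b) (hab : a ≤ b) {m n T : ℕ} (hT : m + 1 + n ≤ T)
    (hz : unnormFilter ν χ q g (m + 1) (fun x => h x * Lop ν q g (m + 1) T x fun _ => 1) = 0)
    (x : X) :
    |weightedDensity ν χ q g h m n x| ≤
      (1 - σm / σp) ^ n * (b - a) * predDensity ν χ q g (m + n) x := by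
  have := M.probν
  obtain ⟨a', b', hab', hd, ha', hb'⟩ := M.weightedDensity_ratio hh ha hb hab m n
  have hL := M.Lop_bdd (m + 1 + n) T (BddMeas.const 1)
  have hN : ∫ y, weightedDensity ν χ q g h m n y *
      (g (m + 1 + n) y * Lop ν q g (m + 1 + n) T y fun _ => 1) ∂ν = 0 := by
    rw [← M.unnormFilter_mul_Lop hh m n hL, ← hz]
    simp only [Lop_comp M.q_bdd M.g_bdd (Nat.le_add_right (m + 1) n) hT (BddMeas.const 1)]
  have hD : 0 < ∫ y, predDensity ν χ q g (m + n) y *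
      (g (m + 1 + n) y * Lop ν q g (m + 1 + n) T y fun _ => 1) ∂ν := by
    have e : m + 1 + n = m + n + 1 := by lia
    rw [e] at hL hT ⊢
    rw [← M.unnormFilter_succ_eq (m + n) hL, M.unnormFilter_Lop hT (BddMeas.const 1)]
    exact M.unnormFilter_one_pos T
  have hk := (M.g_bdd (m + 1 + n)).mul hL
  have hk0 := fun y => mul_nonneg (M.g_nonneg (m + 1 + n) y) (M.Lop_one_nonneg hT y)
  have iN := ((M.weightedDensity_bdd (χ := χ) hh m n).mul hk).integrable ν
  have iD := ((M.predDensity_bdd (m + n)).mul hk).integrable ν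
  have hlow := integral_mono (iD.const_mul a') iN fun y => by
    simpa only [mul_assoc] using mul_le_mul_of_nonneg_right (ha' y) (hk0 y)
  have hup := integral_mono iN (iD.const_mul b') fun y => by
    simpa only [mul_assoc] using mul_le_mul_of_nonneg_right (hb' y) (hk0 y)
  rw [integral_const_mul, hN] at hlow hup
  exact abs_le_of_ratio_bounds hd (nonpos_of_mul_nonpos_left hlow hD)
    (nonneg_of_mul_nonneg_left hup hD) (fun y => (M.predDensity_pos _ y).le) ha' hb' x

lemma abs_Lop_le (M : MixingModel ν χ q g σm σp cm)
    {h : X → ℝ} (hh : BddMeas h) {a b : ℝ} (ha : ∀ x, a ≤ h x)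
    (hb : ∀ x, h x ≤ b) (hab : a ≤ b) {r s T : ℕ} (hrs : r ≤ s) (hsT : s ≤ T)
    (hz : unnormFilter ν χ q g s (fun x => h x * Lop ν q g s T x fun _ => 1) = 0) (x : X) :
    |Lop ν q g r s x fun y => h y * Lop ν q g s T y fun _ => 1| ≤
      (1 - σm / σp) ^ (s - r) * (b - a) * Lop ν q g r T x fun _ => 1 := by
  obtain ⟨a', b', hab', hd, ha', hb'⟩ := M.Lop_ratio hh ha hb hab hsT (s - r) r (by lia)
  have hhL := hh.mul (M.Lop_bdd s T (BddMeas.const 1))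
  have hL := M.Lop_bdd r T (BddMeas.const 1)
  have hD := M.unnormFilter_one_pos T
  have hlow := M.unnormFilter_mono r ((BddMeas.const a').mul hL) (M.Lop_bdd r s hhL) ha'
  have hup := M.unnormFilter_mono r (M.Lop_bdd r s hhL) ((BddMeas.const b').mul hL) hb'
  rw [unnormFilter_const_mul, M.unnormFilter_Lop (hrs.trans hsT) (BddMeas.const 1),
    M.unnormFilter_Lop hrs hhL, hz] at hlow hup
  exact abs_le_of_ratio_bounds hd (nonpos_of_mul_nonpos_left hlow hD)
    (nonneg_of_mul_nonneg_left hup hD) (fun y => M.Lop_one_nonneg (hrs.trans hsT) y) ha' hb' x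

/-- Variance bound for one step of the particle filter, for a test function dominated by
`ε L_{n+1,T}(·, 1)`. -/
lemma variance_step_le (M : MixingModel ν χ q g σm σp cm)
    {ϑ : ℕ → X → ℝ} {p : ℕ → X → X → ℝ} {n T : ℕ} (hnT : n + 1 ≤ T)
    (hϑmeas : Measurable (ϑ (n + 1))) (hϑpos : ∀ x, 0 < ϑ (n + 1) x) {Θ W ε : ℝ}
    (hϑ : ∀ x, ϑ (n + 1) x ≤ Θ) (hpmeas : Measurable fun pr : X × X => p (n + 1) pr.1 pr.2)
    (hppos : ∀ x y, 0 < p (n + 1) x y) (hω : ∀ x y, omegaFn q g ϑ p (n + 1) x y ≤ W)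
    {F : X → ℝ} (hFm : Measurable F)
    (hF : ∀ y, |F y| ≤ ε * Lop ν q g (n + 1) T y fun _ => 1) :
    philt ν χ q g n (fun x => ϑ (n + 1) x *
        ∫ y, p (n + 1) x y * omegaFn q g ϑ p (n + 1) x y ^ 2 * F y ^ 2 ∂ν) *
      philt ν χ q g n (ϑ (n + 1)) /
      ((unnormFilter ν χ q g T fun _ => 1) / unnormFilter ν χ q g n fun _ => 1) ^ 2 ≤
    ε ^ 2 * ((W * Θ) * (σp / σm) / cm) := by
  have := M.probν
  have hσp : 0 < σp := M.σm_pos.trans_le M.σm_le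
  have hAn := M.unnormFilter_one_pos n
  have hAT := M.unnormFilter_one_pos T
  set L : X → ℝ := fun y => Lop ν q g (n + 1) T y fun _ => 1 with hLdef
  have hL : BddMeas L := M.Lop_bdd _ _ (BddMeas.const 1)
  have hL0 : ∀ y, 0 ≤ L y := M.Lop_one_nonneg hnT
  obtain ⟨x₀⟩ : Nonempty X := by
    have := M.probχ
    exact nonempty_of_isProbabilityMeasure χ
  have hω0 : ∀ x y, 0 ≤ omegaFn q g ϑ p (n + 1) x y := fun x y =>
    div_nonneg (mul_nonneg (M.q_nonneg x y) (M.g_nonneg _ y))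
      (mul_nonneg (hϑpos x).le (hppos x y).le)
  have hW0 : 0 ≤ W := (hω0 x₀ x₀).trans (hω x₀ x₀)
  have hΘ0 : 0 ≤ Θ := (hϑpos x₀).le.trans (hϑ x₀)
  have hωB : BddMeas fun pr : X × X => omegaFn q g ϑ p (n + 1) pr.1 pr.2 := by
    refine ⟨?_, W, fun pr => by rw [abs_of_nonneg (hω0 _ _)]; exact hω _ _⟩
    exact (M.q_bdd.meas.mul ((M.g_bdd _).meas.comp measurable_snd)).div
      ((hϑmeas.comp measurable_fst).mul hpmeas)
  have hϑB : BddMeas (ϑ (n + 1)) :=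
    ⟨hϑmeas, Θ, fun x => by rw [abs_of_pos (hϑpos x)]; exact hϑ x⟩
  have hFB : BddMeas F := by
    obtain ⟨C, hC⟩ := ((BddMeas.const ε).mul hL).bdd
    exact ⟨hFm, C, fun y => (hF y).trans ((le_abs_self _).trans (hC y))⟩
  obtain ⟨a, ha⟩ := M.exists_Lop_one_bounds (q := q) (g := g) hnT
  have ha0 : 0 ≤ a := by
    have h1 := (hL0 x₀).trans (ha x₀).2
    exact nonneg_of_mul_nonneg_right h1 hσp
  have hF2 : ∀ y, F y ^ 2 ≤ ε ^ 2 * (σp * a) * L y := fun y => by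
    have h1 : F y ^ 2 ≤ (ε * L y) ^ 2 := by
      rw [← sq_abs]; exact pow_le_pow_left₀ (abs_nonneg _) (hF y) 2
    have h2 := mul_le_mul_of_nonneg_left (mul_le_mul_of_nonneg_right (ha y).2 (hL0 y))
      (sq_nonneg ε)
    calc F y ^ 2 ≤ (ε * L y) ^ 2 := h1
      _ = ε ^ 2 * (L y * L y) := by ring
      _ ≤ ε ^ 2 * (σp * a * L y) := h2
      _ = _ := by ring
  have hrew : (fun x => ϑ (n + 1) x *
        ∫ y, p (n + 1) x y * omegaFn q g ϑ p (n + 1) x y ^ 2 * F y ^ 2 ∂ν) =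
      fun x => ∫ y, omegaFn q g ϑ p (n + 1) x y * (q x y * g (n + 1) y * F y ^ 2) ∂ν := by
    ext x
    rw [← integral_const_mul]
    congr 1; ext y
    have h1 := (hϑpos x).ne'
    have h2 := (hppos x y).ne'
    rw [omegaFn]; field_simp
  have hGB : BddMeas fun pr : X × X =>
      omegaFn q g ϑ p (n + 1) pr.1 pr.2 * (q pr.1 pr.2 * g (n + 1) pr.2 * F pr.2 ^ 2) := by
    simp only [sq]
    exact hωB.mul ((M.q_bdd.mul ((M.g_bdd _).comp measurable_snd)).mul
      ((hFB.mul hFB).comp measurable_snd))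
  have hnum : unnormFilter ν χ q g n
      (fun x => ∫ y, omegaFn q g ϑ p (n + 1) x y * (q x y * g (n + 1) y * F y ^ 2) ∂ν) ≤
      W * (ε ^ 2 * (σp * a)) * unnormFilter ν χ q g T fun _ => 1 := by
    rw [← M.unnormFilter_Lop hnT (BddMeas.const 1), M.unnormFilter_succ n hL,
      ← unnormFilter_const_mul]
    refine M.unnormFilter_mono n (BddMeas.integral
      (f := fun x y => omegaFn q g ϑ p (n + 1) x y * (q x y * g (n + 1) y * F y ^ 2)) hGB ν)
      ((BddMeas.const _).mul (M.kop_bdd _ hL)) fun x => ?_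
    rw [kop, ← integral_const_mul]
    refine integral_mono ((hGB.comp (k := fun y => (x, y)) (by fun_prop)).integrable ν)
      (((((M.q_right_bdd x).mul (M.g_bdd _)).mul hL).integrable ν).const_mul _) fun y => ?_
    have hqg := mul_nonneg (M.q_nonneg x y) (M.g_nonneg (n + 1) y)
    calc omegaFn q g ϑ p (n + 1) x y * (q x y * g (n + 1) y * F y ^ 2)
        ≤ W * (q x y * g (n + 1) y * (ε ^ 2 * (σp * a) * L y)) :=
          mul_le_mul (hω x y) (mul_le_mul_of_nonneg_left (hF2 y) hqg)
            (mul_nonneg hqg (sq_nonneg _)) hW0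
      _ = _ := by simp only [hLdef]; ring
  have hϑint : unnormFilter ν χ q g n (ϑ (n + 1)) ≤ Θ * unnormFilter ν χ q g n fun _ => 1 := by
    rw [← unnormFilter_const_mul]
    exact M.unnormFilter_mono n hϑB ((BddMeas.const Θ).mul (BddMeas.const 1))
      fun x => by simpa using hϑ x
  have hϑ0 : 0 ≤ unnormFilter ν χ q g n (ϑ (n + 1)) := by
    have := M.unnormFilter_mono n ((BddMeas.const 0).mul (BddMeas.const 1)) hϑB
      fun x => by simpa using (hϑpos x).le
    rwa [unnormFilter_const_mul, zero_mul] at this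
  have hden : cm * (σm * a) * (unnormFilter ν χ q g n fun _ => 1) ≤
      unnormFilter ν χ q g T fun _ => 1 := by
    rw [← M.unnormFilter_Lop hnT (BddMeas.const 1), M.unnormFilter_succ n hL,
      ← unnormFilter_const_mul]
    refine M.unnormFilter_mono n ((BddMeas.const _).mul (BddMeas.const 1)) (M.kop_bdd _ hL)
      fun x => ?_
    have h1 := M.kop_mono (n + 1) (BddMeas.const (σm * a)) hL (fun y => (ha y).1) x
    have h2 := mul_le_mul_of_nonneg_right (M.step_ge (n + 1) (by lia) x)
      (mul_nonneg M.σm_pos.le ha0)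
    rw [← integral_mul_const] at h2
    rw [mul_one]
    exact h2.trans h1
  rw [hrew, philt_eq, philt_eq]
  set A := unnormFilter ν χ q g n fun _ => 1
  set B := unnormFilter ν χ q g T fun _ => 1
  have hcm := M.cm_pos
  have hσm := M.σm_pos
  have hnum' := mul_le_mul hnum hϑint hϑ0
    (mul_nonneg (mul_nonneg hW0 (mul_nonneg (sq_nonneg _) (mul_nonneg hσp.le ha0))) hAT.le)
  rw [div_mul_div_comm, div_pow, div_div_eq_mul_div, div_le_iff₀ (by positivity),
    div_mul_eq_mul_div, div_le_iff₀ (by positivity)]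
  have key : W * (ε ^ 2 * (σp * a)) * B * (Θ * A) ≤ ε ^ 2 * (W * Θ * (σp / σm) / cm) * B ^ 2 := by
    have h1 := mul_le_mul_of_nonneg_left hden
      (show 0 ≤ ε ^ 2 * (W * Θ * (σp / σm) / cm) * B by positivity)
    calc W * (ε ^ 2 * (σp * a)) * B * (Θ * A)
        = ε ^ 2 * (W * Θ * (σp / σm) / cm) * B * (cm * (σm * a) * A) := by field_simp
      _ ≤ ε ^ 2 * (W * Θ * (σp / σm) / cm) * B * B := h1
      _ = _ := by ring
  have h3 := mul_le_mul_of_nonneg_right (hnum'.trans key) (sq_nonneg A)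
  calc _ ≤ _ := h3
    _ = _ := by ring

/-- Variance bound for the initial importance sampling step. -/
lemma variance_init_le (M : MixingModel ν χ q g σm σp cm)
    {ρ₀ : Measure X} [IsProbabilityMeasure ρ₀] {d0 : X → ℝ}
    (hd0meas : Measurable d0) (hd00 : ∀ x, 0 ≤ d0 x)
    (hac : χ = ρ₀.withDensity fun x => ENNReal.ofReal (d0 x)) {W ε : ℝ}
    (hW : ∀ x, d0 x * g 0 x ≤ W) (T : ℕ) {F : X → ℝ} (hFm : Measurable F)
    (hF : ∀ y, |F y| ≤ ε * Lop ν q g 0 T y fun _ => 1) :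
    (∫ x, (d0 x * g 0 x) ^ 2 * F x ^ 2 ∂ρ₀) / (unnormFilter ν χ q g T fun _ => 1) ^ 2 ≤
      ε ^ 2 * (W * (σp / σm) / cm) := by
  have := M.probχ
  have hσp : 0 < σp := M.σm_pos.trans_le M.σm_le
  have hAT := M.unnormFilter_one_pos T
  set L : X → ℝ := fun y => Lop ν q g 0 T y fun _ => 1 with hLdef
  have hL : BddMeas L := M.Lop_bdd _ _ (BddMeas.const 1)
  have hL0 : ∀ y, 0 ≤ L y := M.Lop_one_nonneg (Nat.zero_le T)
  obtain ⟨x₀⟩ : Nonempty X := nonempty_of_isProbabilityMeasure χ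
  have hω0 : ∀ x, 0 ≤ d0 x * g 0 x := fun x => mul_nonneg (hd00 x) (M.g_nonneg 0 x)
  have hW0 : 0 ≤ W := (hω0 x₀).trans (hW x₀)
  have hωB : BddMeas fun x => d0 x * g 0 x :=
    ⟨hd0meas.mul (M.g_bdd 0).meas, W, fun x => by rw [abs_of_nonneg (hω0 x)]; exact hW x⟩
  have hFB : BddMeas F := by
    obtain ⟨C, hC⟩ := ((BddMeas.const ε).mul hL).bdd
    exact ⟨hFm, C, fun y => (hF y).trans ((le_abs_self _).trans (hC y))⟩
  obtain ⟨a, ha⟩ := M.exists_Lop_one_bounds (q := q) (g := g) (Nat.zero_le T)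
  have ha0 : 0 ≤ a := nonneg_of_mul_nonneg_right ((hL0 x₀).trans (ha x₀).2) hσp
  have hB : (unnormFilter ν χ q g T fun _ => 1) = ∫ x, d0 x * g 0 x * L x ∂ρ₀ := by
    have h1 : unnormFilter ν χ q g T (fun _ => 1) = ∫ x, g 0 x * L x ∂χ := rfl
    rw [h1, hac, integral_withDensity_eq_integral_toReal_smul (by fun_prop) (by simp)]
    congr 1; ext x
    rw [ENNReal.toReal_ofReal (hd00 x), smul_eq_mul, mul_assoc]
  have hnum : ∫ x, (d0 x * g 0 x) ^ 2 * F x ^ 2 ∂ρ₀ ≤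
      W * (ε ^ 2 * (σp * a)) * unnormFilter ν χ q g T fun _ => 1 := by
    rw [hB, ← integral_const_mul]
    refine integral_mono ?_ (((hωB.mul hL).integrable ρ₀).const_mul _) fun x => ?_
    · simp only [sq]
      exact ((hωB.mul hωB).mul (hFB.mul hFB)).integrable ρ₀
    · have h1 : F x ^ 2 ≤ (ε * L x) ^ 2 := by
        rw [← sq_abs]; exact pow_le_pow_left₀ (abs_nonneg _) (hF x) 2
      have h2 : (d0 x * g 0 x) ^ 2 ≤ W * (d0 x * g 0 x) := by
        rw [sq]; exact mul_le_mul_of_nonneg_right (hW x) (hω0 x)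
      have h3 : (ε * L x) ^ 2 ≤ ε ^ 2 * (σp * a * L x) := by
        rw [mul_pow, sq (L x)]
        exact mul_le_mul_of_nonneg_left (mul_le_mul_of_nonneg_right (ha x).2 (hL0 x))
          (sq_nonneg ε)
      calc (d0 x * g 0 x) ^ 2 * F x ^ 2 ≤ W * (d0 x * g 0 x) * (ε ^ 2 * (σp * a * L x)) :=
            mul_le_mul h2 (h1.trans h3) (sq_nonneg _) (mul_nonneg hW0 (hω0 x))
        _ = _ := by ring
  have hden : cm * (σm * a) ≤ unnormFilter ν χ q g T fun _ => 1 := by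
    have h1 : unnormFilter ν χ q g T (fun _ => 1) = ∫ x, g 0 x * L x ∂χ := rfl
    rw [h1]
    refine (mul_le_mul_of_nonneg_right M.init_ge (mul_nonneg M.σm_pos.le ha0)).trans ?_
    rw [← integral_mul_const]
    exact integral_mono (((M.g_bdd 0).integrable χ).mul_const _)
      (((M.g_bdd 0).mul hL).integrable χ)
      fun x => mul_le_mul_of_nonneg_left (ha x).1 (M.g_nonneg 0 x)
  set B := unnormFilter ν χ q g T fun _ => 1
  have hcm := M.cm_pos
  have hσm := M.σm_pos
  rw [div_le_iff₀ (by positivity)]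
  refine hnum.trans ?_
  have h1 := mul_le_mul_of_nonneg_left hden
    (show 0 ≤ ε ^ 2 * (W * (σp / σm) / cm) * B by positivity)
  calc W * (ε ^ 2 * (σp * a)) * B
      = ε ^ 2 * (W * (σp / σm) / cm) * B * (cm * (σm * a)) := by field_simp
    _ ≤ ε ^ 2 * (W * (σp / σm) / cm) * B * B := h1
    _ = _ := by ring

end MixingModel

lemma exists_bounds_of_osc [Nonempty X] {h : X → ℝ} (hh : BddMeas h) :
    ∃ a b, (∀ x, a ≤ h x) ∧ (∀ x, h x ≤ b) ∧ a ≤ b ∧ b - a ≤ osc h := by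
  obtain ⟨K, hK⟩ := hh.bdd
  have hbb : BddBelow (Set.range h) := ⟨-K, by rintro _ ⟨x, rfl⟩; exact (abs_le.1 (hK x)).1⟩
  have hba : BddAbove (Set.range h) := ⟨K, by rintro _ ⟨x, rfl⟩; exact (abs_le.1 (hK x)).2⟩
  have hosc : ∀ x y, h x - h y ≤ osc h := fun x y => by
    refine (le_abs_self _).trans (le_ciSup (f := fun pr : X × X => |h pr.1 - h pr.2|)
      ⟨K + K, ?_⟩ (x, y))
    rintro _ ⟨pr, rfl⟩
    exact (abs_sub _ _).trans (add_le_add (hK _) (hK _))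
  refine ⟨⨅ x, h x, ⨆ x, h x, ciInf_le hbb, le_ciSup hba, ciInf_le_ciSup hbb hba, ?_⟩
  have h1 : (⨆ x, h x) - osc h ≤ ⨅ x, h x := le_ciInf fun y => by
    have : (⨆ x, h x) ≤ osc h + h y := ciSup_le fun x => by linarith [hosc x y]
    linarith
  linarith

namespace MixingModel

variable {ν χ : Measure X} {q : X → X → ℝ} {g : ℕ → X → ℝ} {σm σp cm : ℝ}

lemma abs_gstT_le (M : MixingModel ν χ q g σm σp cm) {h : X → ℝ} (hh : BddMeas h) {a b : ℝ}
    (ha : ∀ x, a ≤ h x) (hb : ∀ x, h x ≤ b) (hab : a ≤ b) {m n T : ℕ} (hT : m + 1 + n + 1 ≤ T)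
    (hz : unnormFilter ν χ q g (m + 1) (fun x => h x * Lop ν q g (m + 1) T x fun _ => 1) = 0) :
    Measurable (gstT ν χ q g h (m + 1) (m + 1 + n + 1) T) ∧
    ∀ x, |gstT ν χ q g h (m + 1) (m + 1 + n + 1) T x| ≤
      (1 - σm / σp) ^ (n + 1) * (b - a) * Lop ν q g (m + 1 + n + 1) T x fun _ => 1 := by
  have hA := M.unnormFilter_one_pos (m + 1 + n)
  have heq : gstT ν χ q g h (m + 1) (m + 1 + n + 1) T = fun x =>
      weightedDensity ν χ q g h m (n + 1) x / predDensity ν χ q g (m + 1 + n) x *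
        Lop ν q g (m + 1 + n + 1) T x fun _ => 1 := by
    ext x
    have hp := M.predDensity_pos (m + 1 + n) x
    rw [gstT, Nat.add_sub_cancel, jointSm, M.jointNum_mul_q hh, jointNum_eq ν χ q g (by lia),
      M.unnormFilter_Lop (by lia) (BddMeas.const 1), philt_eq, M.unnormFilter_q]
    field_simp
  rw [heq]
  refine ⟨((M.weightedDensity_bdd hh m (n + 1)).meas.div (M.predDensity_bdd _).meas).mul
    (M.Lop_bdd _ _ (BddMeas.const 1)).meas, fun x => ?_⟩
  have hp := M.predDensity_pos (m + 1 + n) x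
  have hL := M.Lop_one_nonneg hT x
  have hw := M.abs_weightedDensity_le hh ha hb hab (n := n + 1) (by lia) hz x
  rw [show m + (n + 1) = m + 1 + n by lia] at hw
  rw [abs_mul, abs_div, abs_of_pos hp, abs_of_nonneg hL]
  exact mul_le_mul_of_nonneg_right ((div_le_iff₀ hp).2 hw) hL

end MixingModel

lemma one_sub_mul_geom_sum_le {x : ℝ} (hx : 0 ≤ x) (n : ℕ) :
    (1 - x) * ∑ k ∈ Finset.range n, x ^ k ≤ 1 := by
  have h1 := mul_neg_geom_sum x n
  have h2 := pow_nonneg hx n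
  linarith

/-- A two-sided geometric sum with ratio `(1 - a)²` is at most `(1 / a) / (1 - (1 - a)²)`. -/
lemma two_sided_geom_sum_le {a : ℝ} (ha0 : 0 < a) (ha1 : a ≤ 1) {s T : ℕ} :
    ∑ r ∈ Finset.range (s + 1), ((1 - a) ^ (s - r)) ^ 2 +
      ∑ t ∈ Finset.Icc (s + 1) T, ((1 - a) ^ (t - s)) ^ 2 ≤
      (1 / a) / (1 - (1 - a) ^ 2) := by
  set x := (1 - a) ^ 2 with hx
  have hx0 : 0 ≤ x := sq_nonneg _
  have hx1 : 0 < 1 - x := by rw [hx]; nlinarith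
  have e1 : ∑ r ∈ Finset.range (s + 1), ((1 - a) ^ (s - r)) ^ 2 =
      ∑ k ∈ Finset.range (s + 1), x ^ k := by
    rw [← Finset.sum_range_reflect]
    refine Finset.sum_congr rfl fun k hk => ?_
    have hk' := Finset.mem_range.1 hk
    rw [hx, ← pow_mul, ← pow_mul, show s - (s + 1 - 1 - k) = k by lia, mul_comm]
  have e2 : ∑ t ∈ Finset.Icc (s + 1) T, ((1 - a) ^ (t - s)) ^ 2 =
      x * ∑ k ∈ Finset.range (T - s), x ^ k := by
    rw [show Finset.Icc (s + 1) T = Finset.Ico (s + 1) (T + 1) by ext; simp,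
      Finset.sum_Ico_eq_sum_range, Finset.mul_sum, show T + 1 - (s + 1) = T - s by lia]
    refine Finset.sum_congr rfl fun k _ => ?_
    rw [hx, ← pow_mul, ← pow_mul, ← pow_add, show s + 1 + k - s = k + 1 by lia]
    congr 1; ring
  rw [e1, e2, le_div_iff₀ hx1]
  have h1 := one_sub_mul_geom_sum_le hx0 (s + 1)
  have h2 := mul_le_mul_of_nonneg_left (one_sub_mul_geom_sum_le hx0 (T - s)) hx0
  have h3 : 1 + x ≤ 1 / a := by
    rw [le_div_iff₀ ha0, hx]
    nlinarith [mul_nonneg (sub_nonneg.2 ha1) (show 0 ≤ a ^ 2 - a + 1 by nlinarith)]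
  nlinarith

end Helpers

theorem stmt_15 {X : Type*} [MeasurableSpace X] (ν : Measure X) (hν : ν Set.univ = 1)
    (σm σp cm : ℝ) (hσm : 0 < σm) (hσmp : σm ≤ σp) (hcm : 0 < cm)
    (q : X → X → ℝ) (hqmeas : Measurable fun pr : X × X => q pr.1 pr.2)
    (hq : ∀ x y, σm ≤ q x y ∧ q x y ≤ σp)
    (χ : Measure X) [IsProbabilityMeasure χ]
    (g : ℕ → X → ℝ) (hgmeas : ∀ t, Measurable (g t))
    (hg0 : ∀ t x, 0 ≤ g t x) (hgb : ∃ K, ∀ t x, g t x ≤ K)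
    (hχg0 : cm ≤ ∫ x, g 0 x ∂χ)
    (hqg : ∀ t, 1 ≤ t → ∀ x, cm ≤ ∫ y, q x y * g t y ∂ν)
    (ϑ : ℕ → X → ℝ) (hϑmeas : ∀ t, Measurable (ϑ t))
    (hϑpos : ∀ t, 1 ≤ t → ∀ x, 0 < ϑ t x)
    (hϑb : ∃ K, ∀ t, 1 ≤ t → ∀ x, ϑ t x ≤ K)
    (p : ℕ → X → X → ℝ) (hpmeas : ∀ t, Measurable fun pr : X × X => p t pr.1 pr.2)
    (hppos : ∀ t, 1 ≤ t → ∀ x y, 0 < p t x y)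
    (hpint : ∀ t, 1 ≤ t → ∀ x, ∫ y, p t x y ∂ν = 1)
    (hωb : ∃ K, ∀ t, 1 ≤ t → ∀ x y, omegaFn q g ϑ p t x y ≤ K)
    (ρ₀ : Measure X) [IsProbabilityMeasure ρ₀]
    (d0 : X → ℝ) (hd0meas : Measurable d0) (hd00 : ∀ x, 0 ≤ d0 x)
    (hac : χ = ρ₀.withDensity fun x => ENNReal.ofReal (d0 x))
    (hw0b : ∃ K, ∀ x, |d0 x * g 0 x| ≤ K)
    (s T : ℕ) (hs : 1 ≤ s) (hsT : s ≤ T)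
    (h : X → ℝ) (hhm : Measurable h) (hhb : ∃ K, ∀ x, |h x| ≤ K)
    (hzero : phismooth ν χ q g s T h = 0) :
    (∑ r ∈ Finset.range (s + 1),
        Vrs ν ρ₀ χ q g d0 ϑ p r s (fun x => h x * Lop ν q g s T x fun _ => 1)) /
        philt ν χ q g s (fun x => Lop ν q g s T x fun _ => 1) ^ 2 +
      ∑ t ∈ Finset.Icc (s + 1) T,
        philt ν χ q g (t - 1) (upsilon ν χ q g ϑ p h s t T) *
          philt ν χ q g (t - 1) (ϑ t) /
          phipred ν χ q g t (fun x => g t x * Lop ν q g t T x fun _ => 1) ^ 2 ≤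
      osc h ^ 2 / (1 - (1 - σm / σp) ^ 2) *
        ((1 / cm) * (σp / σm) ^ 2 *
            (⨆ r : ℕ, supOmega q g d0 ϑ p r * supTheta ϑ r) +
          σp ^ 4 / (cm ^ 2 * σm ^ 3) *
            (⨆ r : ℕ, supOmega q g d0 ϑ p r * supTheta ϑ r * ⨆ x, |g r x|)) := by
  have hprobν : IsProbabilityMeasure ν := ⟨hν⟩
  have hne : Nonempty X := nonempty_of_isProbabilityMeasure χ
  have hσp : 0 < σp := hσm.trans_le hσmp
  obtain ⟨Kg, hKg⟩ := hgb
  obtain ⟨Kϑ, hKϑ⟩ := hϑb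
  obtain ⟨Kω, hKω⟩ := hωb
  obtain ⟨K₀, hK₀⟩ := hw0b
  have M : MixingModel ν χ q g σm σp cm :=
    { probν := hprobν
      probχ := inferInstance
      σm_pos := hσm
      σm_le := hσmp
      cm_pos := hcm
      q_bdd := ⟨hqmeas, σp, fun pr => by
        rw [abs_of_nonneg (hσm.le.trans (hq _ _).1)]; exact (hq _ _).2⟩
      q_mem := hq
      g_bdd := fun t => ⟨hgmeas t, Kg, fun x => by rw [abs_of_nonneg (hg0 t x)]; exact hKg t x⟩
      g_nonneg := hg0
      init_ge := hχg0
      step_ge := hqg }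
  have hh : BddMeas h := ⟨hhm, hhb⟩
  obtain ⟨a, b, ha, hb, hab, hosc⟩ := exists_bounds_of_osc hh
  have hAs := M.unnormFilter_one_pos s
  have hAT := M.unnormFilter_one_pos T
  have hz : unnormFilter ν χ q g s (fun x => h x * Lop ν q g s T x fun _ => 1) = 0 := by
    rw [phismooth, M.philt_Lop_one hsT, philt_eq] at hzero
    simpa [hAs.ne', hAT.ne'] using hzero
  -- the suprema dominate the weights and the adjustment multipliers
  have hω0 : ∀ t, 1 ≤ t → ∀ x y, 0 ≤ omegaFn q g ϑ p t x y := fun t ht x y =>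
    div_nonneg (mul_nonneg (M.q_nonneg x y) (hg0 t y))
      (mul_nonneg (hϑpos t ht x).le (hppos t ht x y).le)
  have hωabs : ∀ t, 1 ≤ t → ∀ pr : X × X, |omegaFn q g ϑ p t pr.1 pr.2| ≤ Kω := fun t ht pr => by
    rw [abs_of_nonneg (hω0 t ht _ _)]; exact hKω t ht _ _
  have hϑabs : ∀ t, 1 ≤ t → ∀ x, |ϑ t x| ≤ Kϑ := fun t ht x => by
    rw [abs_of_pos (hϑpos t ht x)]; exact hKϑ t ht x
  have hWω : ∀ n x y, omegaFn q g ϑ p (n + 1) x y ≤ supOmega q g d0 ϑ p (n + 1) := by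
    intro n x y
    rw [supOmega, if_neg n.succ_ne_zero]
    refine (le_abs_self _).trans (le_ciSup
      (f := fun pr : X × X => |omegaFn q g ϑ p (n + 1) pr.1 pr.2|) ⟨Kω, ?_⟩ (x, y))
    rintro _ ⟨pr, rfl⟩
    exact hωabs (n + 1) (by lia) pr
  have hΘϑ : ∀ n x, ϑ (n + 1) x ≤ supTheta ϑ (n + 1) := by
    intro n x
    rw [supTheta, if_neg n.succ_ne_zero]
    refine (le_abs_self _).trans (le_ciSup (f := fun x => |ϑ (n + 1) x|) ⟨Kϑ, ?_⟩ x)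
    rintro _ ⟨y, rfl⟩
    exact hϑabs (n + 1) (by lia) y
  have hW0 : ∀ x, d0 x * g 0 x ≤ supOmega q g d0 ϑ p 0 := by
    intro x
    rw [supOmega, if_pos rfl]
    refine (le_abs_self _).trans (le_ciSup (f := fun x => |d0 x * g 0 x|) ⟨K₀, ?_⟩ x)
    rintro _ ⟨y, rfl⟩
    exact hK₀ y
  set S := ⨆ r : ℕ, supOmega q g d0 ϑ p r * supTheta ϑ r with hS
  have hle : ∀ r, supOmega q g d0 ϑ p r * supTheta ϑ r ≤ S := by
    refine le_ciSup ⟨max K₀ (Kω * Kϑ), ?_⟩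
    rintro _ ⟨r, rfl⟩
    rcases Nat.eq_zero_or_pos r with rfl | hr
    · simp only [supOmega, supTheta, if_true, mul_one]
      exact (ciSup_le hK₀).trans (le_max_left _ _)
    · simp only [supOmega, supTheta, if_neg hr.ne']
      refine le_trans ?_ (le_max_right _ _)
      exact mul_le_mul (ciSup_le (hωabs r hr)) (ciSup_le (hϑabs r hr))
        (Real.iSup_nonneg fun _ => abs_nonneg _)
        ((abs_nonneg _).trans (hωabs r hr (hne.some, hne.some)))
  have hnn : ∀ r, 0 ≤ supOmega q g d0 ϑ p r * supTheta ϑ r := by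
    refine fun r => mul_nonneg ?_ ?_
    · unfold supOmega; split_ifs <;> exact Real.iSup_nonneg fun _ => abs_nonneg _
    · unfold supTheta; split_ifs
      · exact zero_le_one
      · exact Real.iSup_nonneg fun _ => abs_nonneg _
  have hS0 : 0 ≤ S := Real.iSup_nonneg hnn
  set C := S * (σp / σm) / cm with hC
  have hC0 : 0 ≤ C := by positivity
  have hCle : ∀ r, supOmega q g d0 ϑ p r * supTheta ϑ r * (σp / σm) / cm ≤ C := fun r => by
    rw [hC]; gcongr; exact hle r
  have hscale : ∀ (k : ℕ) (c : ℝ), c ≤ C → ((1 - σm / σp) ^ k * (b - a)) ^ 2 * c ≤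
      ((1 - σm / σp) ^ k) ^ 2 * (osc h ^ 2 * C) := fun k c hc => by
    have h1 : (b - a) ^ 2 ≤ osc h ^ 2 := pow_le_pow_left₀ (sub_nonneg.2 hab) hosc 2
    calc ((1 - σm / σp) ^ k * (b - a)) ^ 2 * c ≤ ((1 - σm / σp) ^ k * (b - a)) ^ 2 * C :=
          mul_le_mul_of_nonneg_left hc (sq_nonneg _)
      _ = ((1 - σm / σp) ^ k) ^ 2 * ((b - a) ^ 2 * C) := by ring
      _ ≤ _ := mul_le_mul_of_nonneg_left (mul_le_mul_of_nonneg_right h1 hC0) (sq_nonneg _)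
  have hhL := hh.mul (M.Lop_bdd s T (BddMeas.const 1))
  have hback : ∀ r ∈ Finset.range (s + 1),
      Vrs ν ρ₀ χ q g d0 ϑ p r s (fun x => h x * Lop ν q g s T x fun _ => 1) /
        philt ν χ q g s (fun x => Lop ν q g s T x fun _ => 1) ^ 2 ≤
      ((1 - σm / σp) ^ (s - r)) ^ 2 * (osc h ^ 2 * C) := by
    intro r hr
    have hrs : r ≤ s := Nat.lt_succ_iff.1 (Finset.mem_range.1 hr)
    have hF := M.abs_Lop_le hh ha hb hab hrs hsT hz
    have hFm := (M.Lop_bdd r s hhL).meas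
    rw [M.philt_Lop_one hsT]
    cases r with
    | zero =>
      have h1 := M.variance_init_le hd0meas hd00 hac hW0 T hFm hF
      have h2 := hCle 0
      rw [supTheta, if_pos rfl, mul_one] at h2
      refine le_trans (le_of_eq ?_) (h1.trans (hscale (s - 0) _ h2))
      rw [Vrs, if_pos rfl, V0]
      change _ / (unnormFilter ν χ q g s fun _ => 1) ^ 2 / _ = _
      field_simp
    | succ n =>
      have hAn := M.unnormFilter_one_pos n
      have h1 := M.variance_step_le (hrs.trans hsT) (hϑmeas (n + 1)) (hϑpos (n + 1) (by lia))
        (hΘϑ n) (hpmeas (n + 1)) (hppos (n + 1) (by lia)) (hWω n) hFm hF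
      refine le_trans (le_of_eq ?_) (h1.trans (hscale _ _ (hCle (n + 1))))
      rw [Vrs, if_neg n.succ_ne_zero, Vr, M.phipred_Lop_one hrs, Nat.add_sub_cancel]
      field_simp
  have hforw : ∀ t ∈ Finset.Icc (s + 1) T,
      philt ν χ q g (t - 1) (upsilon ν χ q g ϑ p h s t T) * philt ν χ q g (t - 1) (ϑ t) /
        phipred ν χ q g t (fun x => g t x * Lop ν q g t T x fun _ => 1) ^ 2 ≤
      ((1 - σm / σp) ^ (t - s)) ^ 2 * (osc h ^ 2 * C) := by
    intro t ht
    obtain ⟨hst, htT⟩ := Finset.mem_Icc.1 ht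
    obtain ⟨m, rfl⟩ : ∃ m, s = m + 1 := ⟨s - 1, by lia⟩
    obtain ⟨n, rfl⟩ : ∃ n, t = m + 1 + n + 1 := ⟨t - (m + 1) - 1, by lia⟩
    obtain ⟨hFm, hF⟩ := M.abs_gstT_le hh ha hb hab htT hz
    have h1 := M.variance_step_le htT (hϑmeas _) (hϑpos _ (by lia)) (hΘϑ _) (hpmeas _)
      (hppos _ (by lia)) (hWω _) hFm hF
    rw [M.phipred_Lop_one htT, Nat.add_sub_cancel,
      show m + 1 + n + 1 - (m + 1) = n + 1 by lia]
    exact h1.trans (hscale _ _ (hCle _))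
  have hsum := add_le_add (Finset.sum_le_sum hback) (Finset.sum_le_sum hforw)
  rw [← Finset.sum_mul, ← Finset.sum_mul, ← add_mul, ← Finset.sum_div] at hsum
  have ha0 : 0 < σm / σp := div_pos hσm hσp
  have ha1 : σm / σp ≤ 1 := (div_le_one hσp).2 hσmp
  have hgeom := mul_le_mul_of_nonneg_right (two_sided_geom_sum_le ha0 ha1 (s := s) (T := T))
    (mul_nonneg (sq_nonneg (osc h)) hC0)
  have hρ : 0 < 1 - (1 - σm / σp) ^ 2 := by nlinarith
  have hSg : 0 ≤ ⨆ r : ℕ, supOmega q g d0 ϑ p r * supTheta ϑ r * ⨆ x, |g r x| :=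
    Real.iSup_nonneg fun r => mul_nonneg (hnn r) (Real.iSup_nonneg fun _ => abs_nonneg _)
  refine (hsum.trans hgeom).trans ?_
  calc 1 / (σm / σp) / (1 - (1 - σm / σp) ^ 2) * (osc h ^ 2 * C)
      = osc h ^ 2 / (1 - (1 - σm / σp) ^ 2) * (1 / cm * (σp / σm) ^ 2 * S) := by
        rw [hC, one_div_div]; ring
    _ ≤ _ := by
        refine mul_le_mul_of_nonneg_left (le_add_of_nonneg_right ?_) (by positivity)
        exact mul_nonneg (by positivity) hSg
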